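/- Violation probability of the primal-dual certificate: let ε_p, ε_d, β_p, β_d ∈ (0,1), Δ_p, Δ_d > 0, Δ_gap ≥ 0, set Δ = Δ_p + Δ_d + Δ_gap, and let N_p, N_d ∈ ℕ satisfy N_p ≥ ln(1/β_p)/ln(1/(1−ε_p)) and N_d ≥ ln(1/β_d)/ln(1/(1−ε_d)). Define S_p = {I : V̂(I) ≤ V*(I) + Δ_p and I ∈ F}, S_d = {I : Ĝ(I) ≥ G*(I) − Δ_d}, and T = {I : V̂(I) − Ĝ(I) ≤ Δ and I ∈ F}. Then the product measure μ^{N_p} ⊗ μ^{N_d} of the event {((I^1,…,I^{N_p}), (J^1,…,J^{N_d})) : I^i ∈ S_p for all i, J^j ∈ S_d for all j, and μ(T) < 1 − (ε_p + ε_d)} is at most β_p + β_d. -/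

import Mathlib

open MeasureTheory

lemma one_sub_pow_le_of_log_div_log_le {ε β : ℝ} (hε : ε ∈ Set.Ioo (0 : ℝ) 1) (hβ : 0 < β)
    {N : ℕ} (hN : Real.log (1 / β) / Real.log (1 / (1 - ε)) ≤ (N : ℝ)) :
    (1 - ε) ^ N ≤ β := by
  have h1 : 0 < 1 - ε := sub_pos.2 hε.2
  have hlog : Real.log (1 - ε) < 0 := Real.log_neg h1 (by linarith [hε.1])
  rw [one_div, one_div, Real.log_inv, Real.log_inv, div_le_iff₀ (by linarith)] at hN
  rw [← Real.log_le_log_iff (pow_pos h1 N) hβ, Real.log_pow]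
  linarith

/-- If `S` has probability at most `1 - ε`, then `N ≥ ln(1/β)/ln(1/(1-ε))` independent samples
all lie in `S` with probability at most `β`. -/
lemma measure_pi_forall_mem_le {I : Type*} [MeasurableSpace I] (μ : Measure I)
    [IsProbabilityMeasure μ] {S : Set I} {ε β : ℝ} (hε : ε ∈ Set.Ioo (0 : ℝ) 1) (hβ : 0 < β)
    {N : ℕ} (hN : Real.log (1 / β) / Real.log (1 / (1 - ε)) ≤ (N : ℝ))
    (hS : μ.real S ≤ 1 - ε) :
    (Measure.pi fun _ : Fin N => μ) (Set.univ.pi fun _ => S) ≤ ENNReal.ofReal β := by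
  rw [Measure.pi_pi, Finset.prod_const, Finset.card_univ, Fintype.card_fin,
    ← ofReal_measureReal, ← ENNReal.ofReal_pow measureReal_nonneg]
  exact ENNReal.ofReal_le_ofReal ((pow_le_pow_left₀ measureReal_nonneg hS N).trans
    (one_sub_pow_le_of_log_div_log_le hε hβ hN))

/-- Violation probability of the primal-dual certificate: with
`Δ = Δ_p + Δ_d + Δ_gap`, success sets
`S_p = {I : V̂(I) ≤ V*(I) + Δ_p and I ∈ F}`, `S_d = {I : Ĝ(I) ≥ G*(I) − Δ_d}`
and `T = {I : V̂(I) − Ĝ(I) ≤ Δ and I ∈ F}`, and independent samples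
`N_p ≥ ln(1/β_p)/ln(1/(1−ε_p))`, `N_d ≥ ln(1/β_d)/ln(1/(1−ε_d))`, the
probability that all primal samples lie in `S_p`, all dual samples lie in
`S_d`, while `μ(T) < 1 − (ε_p + ε_d)`, is at most `β_p + β_d`. -/
theorem primal_dual_violation_probability
    {I : Type*} [MeasurableSpace I] (μ : Measure I) [IsProbabilityMeasure μ]
    (Vhat Vstar Ghat Gstar : I → ℝ)
    (hVhat : Measurable Vhat) (hVstar : Measurable Vstar)
    (hGhat : Measurable Ghat) (hGstar : Measurable Gstar)
    (F : Set I) (hF : MeasurableSet F)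
    (εp εd βp βd : ℝ)
    (hεp : εp ∈ Set.Ioo (0 : ℝ) 1) (hεd : εd ∈ Set.Ioo (0 : ℝ) 1)
    (hβp : βp ∈ Set.Ioo (0 : ℝ) 1) (hβd : βd ∈ Set.Ioo (0 : ℝ) 1)
    (Δp Δd Δgap : ℝ) (hΔp : 0 < Δp) (hΔd : 0 < Δd) (hΔgap : 0 ≤ Δgap)
    -- maximum duality gap bound
    (hgap : ∀ J : I, Vstar J - Gstar J ≤ Δgap)
    (Np Nd : ℕ)
    (hNp : Real.log (1 / βp) / Real.log (1 / (1 - εp)) ≤ (Np : ℝ))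
    (hNd : Real.log (1 / βd) / Real.log (1 / (1 - εd)) ≤ (Nd : ℝ)) :
    ((Measure.pi fun _ : Fin Np => μ).prod (Measure.pi fun _ : Fin Nd => μ))
        {qq : (Fin Np → I) × (Fin Nd → I) |
          (∀ i : Fin Np,
            qq.1 i ∈ {J : I | Vhat J ≤ Vstar J + Δp ∧ J ∈ F}) ∧
          (∀ j : Fin Nd, qq.2 j ∈ {J : I | Gstar J - Δd ≤ Ghat J}) ∧
          μ {J : I | Vhat J - Ghat J ≤ Δp + Δd + Δgap ∧ J ∈ F} <
            ENNReal.ofReal (1 - (εp + εd))} ≤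
      ENNReal.ofReal (βp + βd) := by
  set Sp : Set I := {J : I | Vhat J ≤ Vstar J + Δp ∧ J ∈ F}
  set Sd : Set I := {J : I | Gstar J - Δd ≤ Ghat J}
  set T : Set I := {J : I | Vhat J - Ghat J ≤ Δp + Δd + Δgap ∧ J ∈ F}
  have hsub : Sp ∩ Sd ⊆ T := by
    rintro J ⟨⟨h1, hJF⟩, h2⟩
    have h2' : Gstar J - Δd ≤ Ghat J := h2
    exact ⟨by linarith [hgap J], hJF⟩
  by_cases hT : μ T < ENNReal.ofReal (1 - (εp + εd))
  swap
  · simp [hT]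
  have hTr : μ.real T < 1 - (εp + εd) := by
    rw [← ofReal_measureReal] at hT
    exact (ENNReal.ofReal_lt_ofReal_iff_of_nonneg measureReal_nonneg).1 hT
  have hSd_meas : MeasurableSet Sd := measurableSet_le (hGstar.sub_const Δd) hGhat
  have hsum : μ.real Sp + μ.real Sd ≤ 1 + μ.real T := by
    rw [← measureReal_union_add_inter hSd_meas]
    exact add_le_add measureReal_le_one (measureReal_mono hsub)
  rcases le_or_gt (μ.real Sp) (1 - εp) with hp | hp
  · calc _ ≤ ((Measure.pi fun _ : Fin Np => μ).prod (Measure.pi fun _ : Fin Nd => μ))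
          ((Set.univ.pi fun _ => Sp) ×ˢ Set.univ) :=
          measure_mono fun q hq => ⟨fun i _ => hq.1 i, trivial⟩
      _ ≤ ENNReal.ofReal βp := by
          rw [Measure.prod_prod, measure_univ, mul_one]
          exact measure_pi_forall_mem_le μ hεp hβp.1 hNp hp
      _ ≤ _ := ENNReal.ofReal_le_ofReal (by linarith [hβd.1])
  · calc _ ≤ ((Measure.pi fun _ : Fin Np => μ).prod (Measure.pi fun _ : Fin Nd => μ))
          (Set.univ ×ˢ (Set.univ.pi fun _ => Sd)) :=
          measure_mono fun q hq => ⟨trivial, fun j _ => hq.2.1 j⟩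
      _ ≤ ENNReal.ofReal βd := by
          rw [Measure.prod_prod, measure_univ, one_mul]
          exact measure_pi_forall_mem_le μ hεd hβd.1 hNd (by linarith)
      _ ≤ _ := ENNReal.ofReal_le_ofReal (by linarith [hβp.1])
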